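/- Let (δ_n), (h_n) be real sequences with h_n ≠ 0 for all n, let (γ_n) be strictly positive, and set ζ_n = h_n/γ_n. If the infinite product measures ⊗_{n∈ℕ} μ(δ_n, γ_n) and ⊗_{n∈ℕ} μ(δ_n + h_n, γ_n) on ℝ^ℕ are mutually absolutely continuous, and ζ_n → 0, then ∑_n |ζ_n|^m < ∞ for every natural number m ≥ 2. -/

import Mathlib

open MeasureTheory Real Filter

/-- The Cauchy measure on `ℝ` with location parameter `δ` and scale parameter `γ`. -/
noncomputable def cauchyMeasure (δ γ : ℝ) : Measure ℝ :=
  volume.withDensity fun x => ENNReal.ofReal (γ / (π * ((x - δ) ^ 2 + γ ^ 2)))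

open scoped Topology
open Asymptotics
open ProbabilityTheory hiding cauchyMeasure

/-- Chebyshev's inequality for a weighted sum of independent `[0, 1]`-valued variables, at half
the sum of the squared weights. -/
lemma measure_abs_weighted_sum_sub_integral_ge_le {Ω : Type*} [MeasurableSpace Ω] {μ : Measure Ω}
    [IsProbabilityMeasure μ] {X : ℕ → Ω → ℝ} (hX : ∀ i, Measurable (X i))
    (hX01 : ∀ i ω, X i ω ∈ Set.Icc (0 : ℝ) 1) (hind : iIndepFun X μ) (b : ℕ → ℝ) (N : ℕ)
    (hA : 0 < ∑ i ∈ Finset.range N, b i ^ 2) :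
    μ {ω | (∑ i ∈ Finset.range N, b i ^ 2) / 2 ≤
        |∑ i ∈ Finset.range N, b i * X i ω - ∑ i ∈ Finset.range N, b i * ∫ ω, X i ω ∂μ|} ≤
      ENNReal.ofReal (∑ i ∈ Finset.range N, b i ^ 2)⁻¹ := by
  set A := ∑ i ∈ Finset.range N, b i ^ 2 with hAdef
  have hmem : ∀ i, MemLp (X i) 2 μ := fun i =>
    MemLp.of_bound (hX i).aestronglyMeasurable 1 (ae_of_all _ fun ω => by
      rw [Real.norm_eq_abs, abs_of_nonneg (hX01 i ω).1]; exact (hX01 i ω).2)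
  have hmem' : ∀ i, MemLp (fun ω => b i * X i ω) 2 μ := fun i => (hmem i).const_mul (b i)
  have hvar : variance (∑ i ∈ Finset.range N, fun ω => b i * X i ω) μ ≤ A / 4 := by
    rw [IndepFun.variance_sum (fun i _ => hmem' i), hAdef, Finset.sum_div]
    · refine Finset.sum_le_sum fun i _ => ?_
      rw [variance_const_mul]
      have := variance_le_sq_of_bounded (ae_of_all μ (hX01 i)) (hX i).aemeasurable
      nlinarith [sq_nonneg (b i)]
    · intro i _ j _ hij
      exact (hind.indepFun hij).comp (measurable_const_mul (b i)) (measurable_const_mul (b j))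
  have hint : ∫ ω, (∑ i ∈ Finset.range N, fun ω => b i * X i ω) ω ∂μ =
      ∑ i ∈ Finset.range N, b i * ∫ ω, X i ω ∂μ := by
    simp only [Finset.sum_apply]
    rw [integral_finsetSum _ fun i _ => (hmem' i).integrable (by norm_num)]
    simp only [integral_const_mul]
  have hcheb := meas_ge_le_variance_div_sq
    (memLp_finsetSum' (Finset.range N) fun i _ => hmem' i) (half_pos hA)
  rw [hint] at hcheb
  simp only [Finset.sum_apply] at hcheb
  refine hcheb.trans (ENNReal.ofReal_le_ofReal ?_)
  rw [div_le_iff₀ (by positivity)]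
  refine hvar.trans (le_of_eq ?_)
  field_simp
  norm_num

/-- Absolute continuity `Q ≪ P` turns `P`-negligible sequences of events into `Q`-negligible
ones. -/
lemma MeasureTheory.Measure.AbsolutelyContinuous.tendsto_measure_zero {Ω ι : Type*}
    [MeasurableSpace Ω] {P Q : Measure Ω} [IsFiniteMeasure P] [IsFiniteMeasure Q] (hQP : Q ≪ P)
    {l : Filter ι} {s : ι → Set Ω} (hs : Tendsto (fun i => P (s i)) l (𝓝 0)) :
    Tendsto (fun i => Q (s i)) l (𝓝 0) := by
  have := tendsto_setLIntegral_zero (f := Q.rnDeriv P) (Measure.lintegral_rnDeriv_lt_top Q P).ne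
    (s := s) (l := l) hs
  simpa only [Measure.setLIntegral_rnDeriv hQP] using this

/-- If `Q ≪ P` and the `[0, 1]`-valued variables `X i` are independent under both measures, then
the differences of their means are square summable. -/
lemma summable_sq_integral_sub_integral {Ω : Type*} [MeasurableSpace Ω] {P Q : Measure Ω}
    [IsProbabilityMeasure P] [IsProbabilityMeasure Q] (hQP : Q ≪ P) {X : ℕ → Ω → ℝ}
    (hX : ∀ i, Measurable (X i)) (hX01 : ∀ i ω, X i ω ∈ Set.Icc (0 : ℝ) 1)
    (hindP : iIndepFun X P) (hindQ : iIndepFun X Q) :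
    Summable fun i => (∫ ω, X i ω ∂Q - ∫ ω, X i ω ∂P) ^ 2 := by
  by_contra hsum
  rw [not_summable_iff_tendsto_nat_atTop_of_nonneg fun i => sq_nonneg _] at hsum
  set b : ℕ → ℝ := fun i => ∫ ω, X i ω ∂Q - ∫ ω, X i ω ∂P with hb
  have hpos := hsum.eventually_gt_atTop 0
  have hinv : Tendsto (fun N => ENNReal.ofReal (∑ i ∈ Finset.range N, b i ^ 2)⁻¹) atTop (𝓝 0) := by
    simpa using ENNReal.tendsto_ofReal hsum.inv_tendsto_atTop
  let B (μ : Measure Ω) (N : ℕ) : Set Ω := {ω | (∑ i ∈ Finset.range N, b i ^ 2) / 2 ≤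
    |∑ i ∈ Finset.range N, b i * X i ω - ∑ i ∈ Finset.range N, b i * ∫ ω, X i ω ∂μ|}
  have hB (μ : Measure Ω) [IsProbabilityMeasure μ] (hind : iIndepFun X μ) :
      Tendsto (fun N => μ (B μ N)) atTop (𝓝 0) :=
    tendsto_of_tendsto_of_tendsto_of_le_of_le' tendsto_const_nhds hinv
      (Eventually.of_forall fun _ => zero_le) (hpos.mono fun N hN =>
        measure_abs_weighted_sum_sub_integral_ge_le hX hX01 hind b N hN)
  have hlim := (hQP.tendsto_measure_zero (hB P hindP)).add (hB Q hindQ)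
  have hcover : ∀ N, 1 ≤ Q (B P N) + Q (B Q N) := fun N => by
    rw [← measure_univ (μ := Q)]
    refine (measure_mono fun ω _ => ?_).trans (measure_union_le _ _)
    by_contra! hω
    simp only [B, Set.mem_union, Set.mem_ofPred_eq, not_or, not_le, abs_lt] at hω
    have hdiff : ∑ i ∈ Finset.range N, b i ^ 2 = ∑ i ∈ Finset.range N, b i * ∫ ω, X i ω ∂Q -
        ∑ i ∈ Finset.range N, b i * ∫ ω, X i ω ∂P := by
      rw [← Finset.sum_sub_distrib]
      exact Finset.sum_congr rfl fun i _ => by simp only [hb]; ring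
    linarith [hω.1.2, hω.2.1]
  have := ge_of_tendsto' hlim hcover
  simp at this

lemma isProbabilityMeasure_cauchyMeasure (δ : ℝ) {γ : ℝ} (hγ : 0 < γ) :
    IsProbabilityMeasure (cauchyMeasure δ γ) := by
  lift γ to NNReal using hγ.le
  have hγ' : γ ≠ 0 := by rintro rfl; simp at hγ
  have : cauchyMeasure δ γ = ProbabilityTheory.cauchyMeasure δ γ := by
    rw [cauchyMeasure_of_scale_ne_zero δ hγ', cauchyMeasure]
    congr 1
    ext x
    rw [cauchyPDF_def, cauchyPDFReal_def]
    congr 1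
    field_simp
  rw [this]
  infer_instance

lemma cauchyMeasure_real_Ioi (δ a : ℝ) {γ : ℝ} (hγ : 0 < γ) :
    (cauchyMeasure δ γ).real (Set.Ioi a) = 1 / 2 + arctan ((δ - a) / γ) / π := by
  have hderiv : ∀ x ∈ Set.Ici a, HasDerivAt (fun x => arctan ((x - δ) / γ) / π)
      (γ / (π * ((x - δ) ^ 2 + γ ^ 2))) x := fun x _ => by
    have := ((((hasDerivAt_id x).sub_const δ).div_const γ).arctan).div_const π
    convert! this using 1
    simp only [id]
    have : (x - δ) ^ 2 + γ ^ 2 ≠ 0 := by positivity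
    have : 1 + ((x - δ) / γ) ^ 2 ≠ 0 := by positivity
    field_simp
    ring
  have hnonneg : ∀ x, 0 ≤ γ / (π * ((x - δ) ^ 2 + γ ^ 2)) := fun x => by positivity
  have htop : Tendsto (fun x => arctan ((x - δ) / γ) / π) atTop (𝓝 (π / 2 / π)) := by
    refine Tendsto.div_const ((tendsto_arctan_atTop.mono_right nhdsWithin_le_nhds).comp ?_) π
    exact (tendsto_atTop_add_const_right _ (-δ) tendsto_id).atTop_div_const hγ
  have hint := integral_Ioi_of_hasDerivAt_of_nonneg' hderiv (fun x _ => hnonneg x) htop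
  rw [measureReal_def, cauchyMeasure, withDensity_apply _ measurableSet_Ioi,
    ← integral_eq_lintegral_of_nonneg_ae (ae_of_all _ hnonneg)
      (Measurable.aestronglyMeasurable (by fun_prop)), hint,
    show (a - δ) / γ = -((δ - a) / γ) by ring, arctan_neg]
  field_simp
  ring

/-- The mean, under a product of Cauchy measures, of the indicator that a coordinate exceeds a
threshold. -/
lemma integral_indicator_Ioi_infinitePi_cauchyMeasure (δ a γ : ℕ → ℝ) (hγ : ∀ n, 0 < γ n) (n : ℕ) :
    ∫ ω, (Set.Ioi (a n)).indicator (1 : ℝ → ℝ) (ω n)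
        ∂(Measure.infinitePi fun i => cauchyMeasure (δ i) (γ i)) =
      1 / 2 + arctan ((δ n - a n) / γ n) / π := by
  have (i : ℕ) := isProbabilityMeasure_cauchyMeasure (δ i) (hγ i)
  rw [← cauchyMeasure_real_Ioi _ _ (hγ n), ← integral_indicator_one measurableSet_Ioi,
    ← Measure.infinitePi_map_eval (fun i => cauchyMeasure (δ i) (γ i)) n,
    integral_map (measurable_pi_apply n).aemeasurable]
  exact ((measurable_const (a := (1 : ℝ))).indicator measurableSet_Ioi).aestronglyMeasurable

lemma isBigO_arctan_of_tendsto_zero {α : Type*} {l : Filter α} {z : α → ℝ}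
    (hz : Tendsto z l (𝓝 0)) : z =O[l] fun n => arctan (z n) := by
  have h : (fun x => arctan x - x) =o[𝓝 0] fun x : ℝ => x := by
    simpa using (hasDerivAt_arctan 0).isLittleO
  exact (IsEquivalent.isBigO_symm (u := arctan) (v := fun x => x) h).comp_tendsto hz

theorem cauchy_product_equivalent_implies_summable
    (δ h γ : ℕ → ℝ) (hh : ∀ n, h n ≠ 0) (hγ : ∀ n, 0 < γ n)
    (P Q : Measure (ℕ → ℝ))
    (hP : IsProjectiveLimit P fun I : Finset ℕ =>
      Measure.pi fun i : I => cauchyMeasure (δ i.1) (γ i.1))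
    (hQ : IsProjectiveLimit Q fun I : Finset ℕ =>
      Measure.pi fun i : I => cauchyMeasure (δ i.1 + h i.1) (γ i.1))
    (heq : P ≪ Q ∧ Q ≪ P)
    (hζ : Tendsto (fun n => h n / γ n) atTop (nhds 0)) :
    ∀ m : ℕ, 2 ≤ m → Summable fun n => |h n / γ n| ^ m := by
  have hprobP (i : ℕ) := isProbabilityMeasure_cauchyMeasure (δ i) (hγ i)
  have hprobQ (i : ℕ) := isProbabilityMeasure_cauchyMeasure (δ i + h i) (hγ i)
  obtain rfl := hP.unique
    (Measure.isProjectiveLimit_infinitePi fun i => cauchyMeasure (δ i) (γ i))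
  obtain rfl := hQ.unique
    (Measure.isProjectiveLimit_infinitePi fun i => cauchyMeasure (δ i + h i) (γ i))
  have hmeas (i : ℕ) : Measurable ((Set.Ioi (δ i)).indicator (1 : ℝ → ℝ)) :=
    measurable_const.indicator measurableSet_Ioi
  have hsum := summable_sq_integral_sub_integral heq.2
    (X := fun i ω => (Set.Ioi (δ i)).indicator (1 : ℝ → ℝ) (ω i))
    (fun i => (hmeas i).comp (measurable_pi_apply i))
    (fun i ω => ⟨Set.indicator_nonneg (fun _ _ => zero_le_one) _,
      Set.indicator_le_self' (fun _ _ => zero_le_one) _⟩)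
    (iIndepFun_infinitePi hmeas) (iIndepFun_infinitePi hmeas)
  simp only [integral_indicator_Ioi_infinitePi_cauchyMeasure _ δ γ hγ, add_sub_cancel_left,
    sub_self, zero_div, arctan_zero, add_zero, div_pow] at hsum
  have hsum' : Summable fun n => arctan (h n / γ n) ^ 2 := by
    refine (hsum.mul_right (π ^ 2)).congr fun n => ?_
    field_simp
  intro m hm
  refine summable_of_isBigO_nat hsum' ?_
  have hpow : (fun n => |h n / γ n| ^ m) =O[atTop] fun n => |h n / γ n| ^ 2 := by
    refine IsBigO.of_bound 1 ?_
    filter_upwards [hζ.abs.eventually_le_const (u := 1) (by simp)] with n hn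
    rw [one_mul, norm_of_nonneg (by positivity), norm_of_nonneg (by positivity)]
    exact pow_le_pow_of_le_one (abs_nonneg _) hn hm
  exact hpow.trans ((isBigO_arctan_of_tendsto_zero hζ).abs_left.pow 2)
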